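/- Let A = [[a,b],[b,d]] be a symmetric matrix in SL(2,ℝ) with all entries positive, acting on ℝ² with the standard symplectic form σ((y,η),(y',η')) = ηy' − η'y. For h > 0 let G_h(x) = (πh)^{−1/4} e^{−x²/(2h)}, let U_ω (ω=(y,η)) be the quantum translation U_ω f(x) = e^{(i/h)ηx − (i/2h)yη} f(x−y), and let M_A f(x) = e^{−iπ/4}(2πhb)^{−1/2} ∫_ℝ e^{(i/h)((d/2b)x² − xy/b + (a/2b)y²)} f(y) dy. Then ⟨U_ω G_h, M_A G_h⟩_{L²(ℝ)} = (√2/√(Tr A)) · e^{−⟨A^{−1}ω,ω⟩/(2h·Tr A)} · e^{i⟨ARω,ω⟩/(2h·Tr A)}, where R = [[0,1],[−1,0]]. -/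

import Mathlib

open Matrix

/-- The `L²`-normalized Gaussian `G_h(x) = (πh)^{-1/4} e^{-x²/(2h)}`. -/
noncomputable def Gh (h x : ℝ) : ℂ :=
  (((Real.pi * h) ^ (-(1 : ℝ) / 4) : ℝ) : ℂ) * Complex.exp (-(((x ^ 2) / (2 * h) : ℝ) : ℂ))

/-- The quantum translation `U_ω`, `ω = (y,η)`:
`U_ω f(x) = e^{(i/h)ηx − (i/(2h))yη} f(x−y)`. -/
noncomputable def Uquant (h y η : ℝ) (f : ℝ → ℂ) (x : ℝ) : ℂ :=
  Complex.exp (Complex.I * (((η * x) / h - (y * η) / (2 * h) : ℝ) : ℂ)) * f (x - y)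

/-- The metaplectic operator quantizing the symmetric matrix `[[a,b],[b,d]]`:
`M_A f(x) = e^{−iπ/4}(2πhb)^{−1/2} ∫ e^{(i/h)((d/2b)x² − xy/b + (a/2b)y²)} f(y) dy`. -/
noncomputable def MAop (h a b d : ℝ) (f : ℝ → ℂ) (x : ℝ) : ℂ :=
  Complex.exp (-(Complex.I * Real.pi) / 4) * (((2 * Real.pi * h * b) ^ (-(1 : ℝ) / 2) : ℝ) : ℂ) *
    ∫ y : ℝ, Complex.exp (Complex.I *
      (((d / (2 * b)) * x ^ 2 - x * y / b + (a / (2 * b)) * y ^ 2) / h : ℝ)) * f y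

theorem Complex.ofReal_mul_cpow_half {r : ℝ} (hr : 0 < r) (z : ℂ) :
    ((r : ℂ) * z) ^ (1 / 2 : ℂ) = ((r ^ (1 / 2 : ℝ) : ℝ) : ℂ) * z ^ (1 / 2 : ℂ) := by
  rcases eq_or_ne z 0 with rfl | hz
  · simp
  · have h : (r : ℂ) ≠ 0 := by exact_mod_cast hr.ne'
    rw [Complex.ofReal_cpow hr.le, Complex.cpow_def_of_ne_zero (mul_ne_zero h hz),
      Complex.cpow_def_of_ne_zero h, Complex.cpow_def_of_ne_zero hz, Complex.log_ofReal_mul hr hz,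
      ← Complex.exp_add, Complex.ofReal_log hr.le]
    push_cast
    ring_nf

theorem Complex.I_mul_cpow_half {z : ℂ} (hz : 0 < z.re) :
    (Complex.I * z) ^ (1 / 2 : ℂ)
      = Complex.exp (Complex.I * Real.pi / 4) * z ^ (1 / 2 : ℂ) := by
  have hz0 : z ≠ 0 := by rintro rfl; simp at hz
  have harg := abs_lt.mp (Complex.abs_arg_lt_pi_div_two_iff.mpr (Or.inl hz))
  rw [Complex.cpow_def_of_ne_zero (mul_ne_zero Complex.I_ne_zero hz0),
    Complex.cpow_def_of_ne_zero hz0, Complex.log_mul Complex.I_ne_zero hz0 (by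
      rw [Complex.arg_I]
      constructor <;> linarith [Real.pi_pos, harg.1, harg.2]), Complex.log_I, ← Complex.exp_add]
  ring_nf

/-- The metaplectic operator sends the Gaussian `Gh h` to a Gaussian with complex width. -/
theorem MAop_Gh {h a b d : ℝ} (hh : 0 < h) (ha : 0 < a) (hb : 0 < b)
    (hdet : a * d - b * b = 1) (x : ℝ) :
    MAop h a b d (Gh h) x = (((Real.pi * h) ^ (-(1 : ℝ) / 4) : ℝ) : ℂ) *
      (((a : ℂ) + b * Complex.I)⁻¹) ^ (1 / 2 : ℂ) *
      Complex.exp (-((d - b * Complex.I) / (a + b * Complex.I)) * x ^ 2 / (2 * h)) := by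
  have hhC : (h : ℂ) ≠ 0 := by exact_mod_cast hh.ne'
  have hbC : (b : ℂ) ≠ 0 := by exact_mod_cast hb.ne'
  have hz : (a : ℂ) + b * Complex.I ≠ 0 := fun h0 => by
    have := congrArg Complex.re h0
    simp at this
    exact ha.ne' this
  have hdetC : (a : ℂ) * d - b * b = 1 := by exact_mod_cast hdet
  set z : ℂ := (a : ℂ) + b * Complex.I with hzdef
  have hre : (Complex.I * z / (2 * h * b)).re < 0 := by
    have : Complex.I * z / (2 * h * b) = ((-(1 / (2 * h)) : ℝ) : ℂ)
        + ((a / (2 * h * b) : ℝ) : ℂ) * Complex.I := by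
      rw [hzdef]; push_cast; field_simp; linear_combination (b : ℂ) * Complex.I_sq
    rw [this, Complex.add_re, Complex.re_ofReal_mul, Complex.ofReal_re, Complex.I_re]
    have : 0 < 1 / (2 * h) := by positivity
    linarith
  have hint : (∫ y : ℝ, Complex.exp (Complex.I *
      (((d / (2 * b)) * x ^ 2 - x * y / b + (a / (2 * b)) * y ^ 2) / h : ℝ)) * Gh h y)
      = (((Real.pi * h) ^ (-(1 : ℝ) / 4) : ℝ) : ℂ) * ∫ y : ℝ, Complex.exp
        (Complex.I * z / (2 * h * b) * y ^ 2 + (-(Complex.I * x / (h * b))) * y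
          + Complex.I * d * x ^ 2 / (2 * h * b)) := by
    rw [← MeasureTheory.integral_const_mul]
    congr 1
    funext y
    rw [Gh, mul_left_comm, ← Complex.exp_add]
    congr 2
    rw [hzdef]
    push_cast
    field_simp
    linear_combination (-(b : ℂ) * y ^ 2) * Complex.I_sq
  rw [MAop, hint, integral_cexp_quadratic hre]
  have hpre : (Real.pi / -(Complex.I * z / (2 * h * b)) : ℂ)
      = ((2 * Real.pi * h * b : ℝ) : ℂ) * (Complex.I * z⁻¹) := by
    push_cast
    field_simp
    rw [Complex.I_sq]
  have hzre : 0 < (z⁻¹).re := by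
    rw [Complex.inv_re]
    refine div_pos (by simpa [hzdef] using ha) (Complex.normSq_pos.mpr hz)
  have hpos : 0 < 2 * Real.pi * h * b := by positivity
  rw [hpre, Complex.ofReal_mul_cpow_half hpos, Complex.I_mul_cpow_half hzre]
  have hexp : Complex.I * d * x ^ 2 / (2 * h * b)
      - (-(Complex.I * x / (h * b))) ^ 2 / (4 * (Complex.I * z / (2 * h * b)))
      = -((d - b * Complex.I) / z) * x ^ 2 / (2 * h) := by
    field_simp
    rw [hzdef]
    linear_combination 4 * Complex.I * x ^ 2 * hdetC + 4 * x ^ 2 * d * b * Complex.I_sq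
  rw [hexp]
  have h1 : Complex.exp (-(Complex.I * Real.pi) / 4) * Complex.exp (Complex.I * Real.pi / 4)
      = 1 := by
    rw [← Complex.exp_add, ← Complex.exp_zero]; congr 1; ring
  have h2 : (((2 * Real.pi * h * b) ^ (-(1 : ℝ) / 2) : ℝ) : ℂ)
      * (((2 * Real.pi * h * b) ^ (1 / 2 : ℝ) : ℝ) : ℂ) = 1 := by
    rw [← Complex.ofReal_mul, ← Real.rpow_add hpos]; norm_num
  generalize Complex.exp (-(Complex.I * Real.pi) / 4) = e1 at *
  generalize Complex.exp (Complex.I * Real.pi / 4) = e2 at *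
  generalize (((2 * Real.pi * h * b) ^ (-(1 : ℝ) / 2) : ℝ) : ℂ) = r1 at *
  generalize (((2 * Real.pi * h * b) ^ (1 / 2 : ℝ) : ℝ) : ℂ) = r2 at *
  generalize Complex.exp (-((d - b * Complex.I) / z) * x ^ 2 / (2 * h)) = E
  generalize (((Real.pi * h) ^ (-(1 : ℝ) / 4) : ℝ) : ℂ) = g
  linear_combination (g * (z⁻¹) ^ (1 / 2 : ℂ) * E) * h1
    + (e1 * e2 * g * (z⁻¹) ^ (1 / 2 : ℂ) * E) * h2

/-- Lemma 5.1: for a symmetric `A = [[a,b],[b,d]] ∈ SL(2,ℝ)` with positive entries,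
`⟨U_ω G_h, M_A G_h⟩ = (√2/√Tr A) e^{−⟨A⁻¹ω,ω⟩/(2h Tr A)} e^{i⟨ARω,ω⟩/(2h Tr A)}`,
with `R = [[0,1],[−1,0]]`. -/
theorem stmt12 (h a b d y η : ℝ) (hh : 0 < h) (ha : 0 < a) (hb : 0 < b) (hd : 0 < d)
    (hdet : a * d - b * b = 1) :
    (∫ x : ℝ, Uquant h y η (Gh h) x * (starRingEnd ℂ) (MAop h a b d (Gh h) x))
      = ((Real.sqrt 2 / Real.sqrt ((!![a, b; b, d] : Matrix (Fin 2) (Fin 2) ℝ).trace) : ℝ) : ℂ) *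
        Complex.exp (-(((((!![a, b; b, d] : Matrix (Fin 2) (Fin 2) ℝ)⁻¹ *ᵥ ![y, η]) ⬝ᵥ ![y, η]) /
          (2 * h * (!![a, b; b, d] : Matrix (Fin 2) (Fin 2) ℝ).trace) : ℝ) : ℂ)) *
        Complex.exp (Complex.I *
          (((((!![a, b; b, d] * !![0, 1; -1, 0] : Matrix (Fin 2) (Fin 2) ℝ) *ᵥ ![y, η]) ⬝ᵥ ![y, η]) /
            (2 * h * (!![a, b; b, d] : Matrix (Fin 2) (Fin 2) ℝ).trace) : ℝ) : ℂ)) := by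
  have hT : 0 < a + d := by positivity
  have hhC : (h : ℂ) ≠ 0 := by exact_mod_cast hh.ne'
  have hTC : (a : ℂ) + d ≠ 0 := by exact_mod_cast hT.ne'
  have hwre : ((a : ℂ) - b * Complex.I).re = a := by simp
  have hw : (a : ℂ) - b * Complex.I ≠ 0 := fun h0 => by
    rw [h0] at hwre
    exact ha.ne hwre
  have hzarg : (((a : ℂ) + b * Complex.I)⁻¹).arg ≠ Real.pi := by
    refine fun h0 => absurd (Complex.arg_eq_pi_iff.mp h0).1 (not_lt.mpr ?_)
    rw [Complex.inv_re]
    exact div_nonneg (by simpa using ha.le) (Complex.normSq_nonneg _)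
  have hwarg : ((a : ℂ) - b * Complex.I).arg ≠ Real.pi := fun h0 =>
    absurd (Complex.arg_eq_pi_iff.mp h0).1 (by rw [hwre]; exact not_lt.mpr ha.le)
  have hconj : (starRingEnd ℂ) ((((a : ℂ) + b * Complex.I)⁻¹) ^ (1 / 2 : ℂ))
      = (((a : ℂ) - b * Complex.I) ^ (1 / 2 : ℂ))⁻¹ := by
    rw [← Complex.inv_cpow _ _ hwarg]
    have := Complex.conj_cpow _ (1 / 2 : ℂ) hzarg
    simp only [map_inv₀, map_add, map_mul, map_div₀, map_one, map_ofNat, Complex.conj_ofReal,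
      Complex.conj_I, mul_neg, ← sub_eq_add_neg] at this
    exact this.symm
  set w : ℂ := (a : ℂ) - b * Complex.I with hwdef
  have hre : (-(a + d) / (2 * h * w)).re < 0 := by
    have : -(a + d) / (2 * h * w) = ((-((a + d) / (2 * h)) : ℝ) : ℂ) * w⁻¹ := by
      push_cast; field_simp
    rw [this, Complex.re_ofReal_mul, Complex.inv_re, hwre]
    exact mul_neg_of_neg_of_pos (neg_lt_zero.mpr (by positivity))
      (div_pos ha (Complex.normSq_pos.mpr hw))
  have hint : (∫ x : ℝ, Uquant h y η (Gh h) x * (starRingEnd ℂ) (MAop h a b d (Gh h) x))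
      = ((((Real.pi * h) ^ (-(1 : ℝ) / 4) : ℝ) : ℂ) ^ 2 * (w ^ (1 / 2 : ℂ))⁻¹) *
        ∫ x : ℝ, Complex.exp (-(a + d) / (2 * h * w) * x ^ 2 + (y + η * Complex.I) / h * x
          + -(y ^ 2 + y * η * Complex.I) / (2 * h)) := by
    rw [← MeasureTheory.integral_const_mul]
    congr 1
    funext x
    rw [MAop_Gh hh ha hb hdet, Uquant, Gh, map_mul, map_mul, hconj, ← Complex.exp_conj,
      Complex.conj_ofReal]
    simp only [map_mul, map_neg, map_div₀, map_add, map_sub, map_pow, map_ofNat,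
      Complex.conj_ofReal, Complex.conj_I, mul_neg, ← sub_eq_add_neg, sub_neg_eq_add]
    rw [← hwdef]
    have hE : Complex.exp (-(a + d) / (2 * h * w) * x ^ 2 + (y + η * Complex.I) / h * x
          + -(y ^ 2 + y * η * Complex.I) / (2 * h))
        = Complex.exp (Complex.I * (((η * x) / h - (y * η) / (2 * h) : ℝ) : ℂ))
          * Complex.exp (-((((x - y) ^ 2) / (2 * h) : ℝ) : ℂ))
          * Complex.exp (-((d + b * Complex.I) / w) * x ^ 2 / (2 * h)) := by
      rw [← Complex.exp_add, ← Complex.exp_add]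
      congr 1
      push_cast
      field_simp
      rw [hwdef]
      ring
    rw [hE]
    ring
  have hpre : (Real.pi / -(-(a + d) / (2 * h * w)) : ℂ)
      = ((2 * Real.pi * h / (a + d) : ℝ) : ℂ) * w := by
    push_cast
    field_simp
  have hpos : 0 < 2 * Real.pi * h / (a + d) := by positivity
  have hwp : w ^ (1 / 2 : ℂ) ≠ 0 := by simp [Complex.cpow_eq_zero_iff, hw]
  have hreal : ((Real.pi * h) ^ (-(1 : ℝ) / 4)) ^ 2 * (2 * Real.pi * h / (a + d)) ^ (1 / 2 : ℝ)
      = Real.sqrt 2 / Real.sqrt (a + d) := by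
    have hph : 0 < Real.pi * h := by positivity
    rw [← Real.rpow_natCast, ← Real.rpow_mul hph.le, ← Real.sqrt_eq_rpow,
      show 2 * Real.pi * h / (a + d) = (Real.pi * h) * (2 / (a + d)) by ring,
      Real.sqrt_mul hph.le, Real.sqrt_div zero_le_two, Real.sqrt_eq_rpow (Real.pi * h), ← mul_assoc,
      ← Real.rpow_add hph]
    norm_num
  have hinv : (!![a, b; b, d] : Matrix (Fin 2) (Fin 2) ℝ)⁻¹ = !![d, -b; -b, a] := by
    rw [Matrix.inv_def, Matrix.det_fin_two_of, hdet, Matrix.adjugate_fin_two_of]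
    simp
  rw [hint, integral_cexp_quadratic hre, hpre, Complex.ofReal_mul_cpow_half hpos, hinv,
    Matrix.trace_fin_two_of, ← hreal, mul_assoc _ (Complex.exp _) (Complex.exp _),
    ← Complex.exp_add]
  have hexp : -(y ^ 2 + y * η * Complex.I) / (2 * h)
      - ((y + η * Complex.I) / h) ^ 2 / (4 * (-(a + d) / (2 * h * w)))
      = -((((!![d, -b; -b, a] : Matrix (Fin 2) (Fin 2) ℝ) *ᵥ ![y, η]) ⬝ᵥ ![y, η] /
          (2 * h * (a + d)) : ℝ) : ℂ) + Complex.I *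
        ((((!![a, b; b, d] * !![0, 1; -1, 0] : Matrix (Fin 2) (Fin 2) ℝ) *ᵥ ![y, η]) ⬝ᵥ ![y, η] /
            (2 * h * (a + d)) : ℝ) : ℂ) := by
    rw [neg_div (2 * h * w : ℂ), mul_neg, div_neg, sub_neg_eq_add]
    simp [Matrix.mulVec, dotProduct, Fin.sum_univ_two, Matrix.mul_apply]
    field_simp
    rw [hwdef]
    ring_nf
    simp only [Complex.I_sq, Complex.I_pow_three]
    ring
  rw [hexp]
  push_cast
  field_simp
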